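/- Let A₁, …, A_m be linearly independent diagonal matrices in 𝒟ₙ, with A_k having diagonal (a(k,1),…,a(k,n)). Let i₁, …, i_p be pairwise nonequivalent indices, each of whose components satisfies the *-Property, and such that every index whose component satisfies the *-Property is equivalent to some i_s. Then span{A₁, …, A_m} is a co-Chebyshev subspace of Mₙ (i.e., every T ∈ Mₙ admits a unique best coapproximation out of span{A₁, …, A_m} with respect to the operator norm) if and only if p = m and |S_{i_s}| = 1 for every s ∈ {1,…,p}. -/

import Mathlib

/-- The operator norm of an `n × n` real matrix, induced by the Euclidean norm on `ℝⁿ`. -/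
noncomputable def opNorm {n : ℕ} (A : Matrix (Fin n) (Fin n) ℝ) : ℝ :=
  ‖LinearMap.toContinuousLinearMap (Matrix.toEuclideanLin A)‖

/-- The `i`-th component of the family of diagonals `a`. -/
def comp {m n : ℕ} (a : Fin m → Fin n → ℝ) (i : Fin n) : Fin m → ℝ := fun k => a k i

/-- The positively associated set of the `i`-th component. -/
def Pplus {m n : ℕ} (a : Fin m → Fin n → ℝ) (i : Fin n) : Set (Fin n) :=
  {j | comp a j = comp a i}

/-- The negatively associated set of the `i`-th component. -/
def Pminus {m n : ℕ} (a : Fin m → Fin n → ℝ) (i : Fin n) : Set (Fin n) :=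
  {j | comp a j = -comp a i}

/-- `Sᵢ = Pᵢ⁺ ∪ Pᵢ⁻`. -/
def Sset {m n : ℕ} (a : Fin m → Fin n → ℝ) (i : Fin n) : Set (Fin n) :=
  Pplus a i ∪ Pminus a i

/-- The `i`-th component satisfies the `*`-Property. -/
def StarProperty {m n : ℕ} (a : Fin m → Fin n → ℝ) (i : Fin n) : Prop :=
  ∃ β : Fin m → ℝ, (∑ k, β k * a k i) ≠ 0 ∧
    ∀ j ∉ Sset a i, |∑ k, β k * a k j| < |∑ k, β k * a k i|

/-- Components `i` and `j` are equivalent if `v_j = ± vᵢ`. -/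
def EquivComp {m n : ℕ} (a : Fin m → Fin n → ℝ) (i j : Fin n) : Prop :=
  comp a j = comp a i ∨ comp a j = -comp a i

open Filter

section Combination

variable {m n : ℕ} (a : Fin m → Fin n → ℝ)

/-- The diagonal of `∑ k, β k • A k`, as a linear function of `β`. -/
noncomputable def diagComb : (Fin m → ℝ) →ₗ[ℝ] (Fin n → ℝ) :=
  Fintype.linearCombination ℝ a

theorem diagComb_apply (β : Fin m → ℝ) (j : Fin n) :
    diagComb a β j = ∑ k, β k * a k j := by
  simp [diagComb, Fintype.linearCombination_apply]

theorem mem_span_diagonal_iff (B : Matrix (Fin n) (Fin n) ℝ) :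
    B ∈ Submodule.span ℝ (Set.range fun k => Matrix.diagonal (a k)) ↔
      ∃ β, Matrix.diagonal (diagComb a β) = B := by
  have key : ∀ β : Fin m → ℝ,
      ∑ k, β k • Matrix.diagonal (a k) = Matrix.diagonal (diagComb a β) := by
    intro β
    ext i j
    rw [Matrix.sum_apply]
    by_cases h : i = j
    · subst h; simp [diagComb_apply]
    · simp [h]
  rw [Submodule.mem_span_range_iff_exists_fun]
  simp only [key]

theorem diagComb_injective (ha : LinearIndependent ℝ fun k => Matrix.diagonal (a k)) :
    Function.Injective (diagComb a) := by
  have h : LinearIndependent ℝ a :=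
    LinearIndependent.of_comp (Matrix.diagonalLinearMap (Fin n) ℝ ℝ) ha
  exact h.fintypeLinearCombination_injective

variable {a}

theorem EquivComp.diagComb {i j : Fin n} (h : EquivComp a i j) (β : Fin m → ℝ) :
    diagComb a β j = diagComb a β i ∨ diagComb a β j = -diagComb a β i := by
  rcases h with h | h
  · left
    simp only [diagComb_apply]
    exact Finset.sum_congr rfl fun k _ => by rw [show a k j = a k i from congrFun h k]
  · right
    simp only [diagComb_apply, ← Finset.sum_neg_distrib]
    exact Finset.sum_congr rfl fun k _ => by
      rw [show a k j = -a k i from congrFun h k, mul_neg]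

theorem EquivComp.abs_diagComb {i j : Fin n} (h : EquivComp a i j) (β : Fin m → ℝ) :
    |_root_.diagComb a β j| = |_root_.diagComb a β i| :=
  abs_eq_abs.mpr (h.diagComb β)

theorem mem_Sset_iff {i j : Fin n} : j ∈ Sset a i ↔ EquivComp a i j := Iff.rfl

theorem EquivComp.symm {i j : Fin n} (h : EquivComp a i j) : EquivComp a j i := by
  rcases h with h | h
  · exact Or.inl h.symm
  · exact Or.inr (by rw [h, neg_neg])

theorem EquivComp.trans {i j k : Fin n} (h : EquivComp a i j) (h' : EquivComp a j k) :
    EquivComp a i k := by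
  unfold EquivComp at *
  rcases h with h | h <;> rcases h' with h' | h' <;> simp [h, h']

/-- The functional in the `*`-Property may be normalized to take the value `1` at `i`. -/
theorem StarProperty.exists_normalized {i : Fin n} (h : StarProperty a i) :
    ∃ β, diagComb a β i = 1 ∧ ∀ j, ¬ EquivComp a i j → |diagComb a β j| < 1 := by
  obtain ⟨β, h0, hlt⟩ := h
  simp only [← diagComb_apply] at h0 hlt
  refine ⟨(diagComb a β i)⁻¹ • β, by simp [h0], fun j hj => ?_⟩
  have := hlt j (mt mem_Sset_iff.mp hj)
  rw [map_smul, Pi.smul_apply, smul_eq_mul, abs_mul, abs_inv,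
    inv_mul_lt_iff₀ (abs_pos.mpr h0), mul_one]
  exact this

theorem abs_diagComb_comp_lt {i j : Fin n} (hij : ¬ EquivComp a i j)
    (hle : ∑ k, a k j ^ 2 ≤ ∑ k, a k i ^ 2) :
    |diagComb a (comp a i) j| < diagComb a (comp a i) i := by
  simp only [EquivComp, not_or] at hij
  obtain ⟨h1, h2⟩ := hij
  have e : ∀ σ : ℝ, ∑ k, (a k j - σ * a k i) ^ 2 =
      ∑ k, a k j ^ 2 - 2 * σ * diagComb a (comp a i) j + σ ^ 2 * ∑ k, a k i ^ 2 := by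
    intro σ
    simp only [diagComb_apply, comp, Finset.mul_sum]
    rw [← Finset.sum_sub_distrib, ← Finset.sum_add_distrib]
    exact Finset.sum_congr rfl fun k _ => by ring
  have hi : diagComb a (comp a i) i = ∑ k, a k i ^ 2 := by
    simp only [diagComb_apply, comp]
    exact Finset.sum_congr rfl fun k _ => by ring
  have pos : ∀ σ : ℝ, comp a j ≠ σ • comp a i → 0 < ∑ k, (a k j - σ * a k i) ^ 2 := by
    intro σ hσ
    obtain ⟨k, hk⟩ := Function.ne_iff.mp hσ
    refine Finset.sum_pos' (fun _ _ => sq_nonneg _) ⟨k, Finset.mem_univ _, ?_⟩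
    have : a k j - σ * a k i ≠ 0 := sub_ne_zero.mpr hk
    positivity
  have p1 := pos 1 (by simpa using h1)
  have p2 := pos (-1) (by simpa using h2)
  rw [e] at p1 p2
  rw [abs_lt, hi]
  constructor <;> linarith

theorem eventually_add_lt {x y u v : ℝ} (hxy : x ≤ y) (h : x < y ∨ u < v) :
    ∀ᶠ N : ℝ in atTop, N * x + u < N * y + v := by
  rcases hxy.lt_or_eq with hlt | rfl
  · filter_upwards [eventually_gt_atTop ((u - v) / (y - x))] with N hN
    rw [div_lt_iff₀ (sub_pos.mpr hlt)] at hN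
    linarith
  · have := h.resolve_left (lt_irrefl _)
    exact Eventually.of_forall fun N => by linarith

/-- A nonzero combination attains its norm at a component with the `*`-Property. -/
theorem exists_starProperty_max (β : Fin m → ℝ) (hβ : diagComb a β ≠ 0) :
    ∃ i, StarProperty a i ∧ ∀ j, |diagComb a β j| ≤ |diagComb a β i| := by
  classical
  obtain ⟨l, hl⟩ := Function.ne_iff.mp hβ
  have : Nonempty (Fin n) := ⟨l⟩
  obtain ⟨i₀, hi₀⟩ := Finite.exists_max fun j => |diagComb a β j|
  obtain ⟨i, hi, hmax⟩ := Finset.exists_max_image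
    (Finset.univ.filter fun j => |diagComb a β j| = |diagComb a β i₀|)
    (fun j => ∑ k, a k j ^ 2) ⟨i₀, by simp⟩
  simp only [Finset.mem_filter, Finset.mem_univ, true_and] at hi hmax
  have hle : ∀ j, |diagComb a β j| ≤ |diagComb a β i| := fun j => hi ▸ hi₀ j
  have hpos : 0 < |diagComb a β i| := (abs_pos.mpr hl).trans_le (hle l)
  refine ⟨i, ?_, hle⟩
  have ev : ∀ᶠ N : ℝ in atTop, ∀ j, ¬ EquivComp a i j →
      N * |diagComb a β j| + |diagComb a (comp a i) j| <
        N * |diagComb a β i| + diagComb a (comp a i) i := by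
    rw [eventually_all]
    intro j
    by_cases hj : EquivComp a i j
    · exact Eventually.of_forall fun N h => absurd hj h
    · refine (eventually_add_lt (hle j) ?_).mono fun N h _ => h
      rcases (hle j).lt_or_eq with h | h
      · exact Or.inl h
      · exact Or.inr (abs_diagComb_comp_lt hj (hmax j (h.trans hi)))
  obtain ⟨N, hN, hN0⟩ := (ev.and (eventually_gt_atTop 0)).exists
  have hGi : 0 ≤ diagComb a (comp a i) i := by
    rw [diagComb_apply]
    exact Finset.sum_nonneg fun k _ => mul_self_nonneg _
  have hval : ∀ j, diagComb a
      ((N * SignType.sign (diagComb a β i)) • β + comp a i) j =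
      N * (SignType.sign (diagComb a β i) * diagComb a β j) + diagComb a (comp a i) j := by
    intro j; simp [mul_assoc]
  have hvi := hval i
  rw [sign_mul_self] at hvi
  have hi_pos : 0 < N * |diagComb a β i| + diagComb a (comp a i) i := by positivity
  refine ⟨(N * SignType.sign (diagComb a β i)) • β + comp a i, ?_, fun j hj => ?_⟩
  · rw [← diagComb_apply, hvi]; exact hi_pos.ne'
  · simp only [← diagComb_apply]
    rw [hvi, abs_of_pos hi_pos, hval]
    refine lt_of_le_of_lt ?_ (hN j hj)
    refine (abs_add_le _ _).trans (add_le_add_left ?_ _)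
    rw [abs_mul, abs_of_pos hN0, abs_mul]
    have : |((SignType.sign (diagComb a β i) : SignType) : ℝ)| ≤ 1 := by
      cases SignType.sign (diagComb a β i) <;> simp
    gcongr
    exact mul_le_of_le_one_left (abs_nonneg _) this

end Combination

section OperatorNorm

open scoped Matrix.Norms.L2Operator InnerProductSpace

variable {n : ℕ}

theorem opNorm_eq_norm (A : Matrix (Fin n) (Fin n) ℝ) : opNorm A = ‖A‖ := rfl

theorem opNorm_nonneg (A : Matrix (Fin n) (Fin n) ℝ) : 0 ≤ opNorm A := norm_nonneg _

theorem opNorm_neg (A : Matrix (Fin n) (Fin n) ℝ) : opNorm (-A) = opNorm A := by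
  simp only [opNorm_eq_norm, norm_neg]

theorem opNorm_diagonal_le {d : Fin n → ℝ} {r : ℝ} (hr : 0 ≤ r) (h : ∀ j, |d j| ≤ r) :
    opNorm (Matrix.diagonal d) ≤ r := by
  rw [opNorm_eq_norm, Matrix.l2_opNorm_diagonal]
  exact (pi_norm_le_iff_of_nonneg hr).mpr h

theorem inner_toEuclideanLin_single (A : Matrix (Fin n) (Fin n) ℝ) (i : Fin n) :
    ⟪Matrix.toEuclideanLin A (EuclideanSpace.single i 1), EuclideanSpace.single i 1⟫_ℝ =
      A i i := by
  simp [EuclideanSpace.inner_single_right, Matrix.toLpLin_apply]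

theorem abs_diag_le_opNorm (A : Matrix (Fin n) (Fin n) ℝ) (i : Fin n) :
    |A i i| ≤ opNorm A := by
  rw [← inner_toEuclideanLin_single A i]
  refine (abs_real_inner_le_norm _ _).trans ?_
  have := (LinearMap.toContinuousLinearMap (Matrix.toEuclideanLin A)).le_opNorm
    (EuclideanSpace.single i 1)
  simpa [opNorm] using this

/-- If `D` fixes the unit vector `e` and contracts its orthogonal complement strictly, then
the one-sided derivative of the norm at `D` in the direction `T` is at most `⟪T e, e⟫`. -/
theorem eventually_norm_add_smul_le {E : Type*} [NormedAddCommGroup E] [InnerProductSpace ℝ E]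
    (T D : E →L[ℝ] E) {e : E} (he : ‖e‖ = 1) (hDe : D e = e) {q : ℝ} (hq1 : q < 1)
    (hq0 : 0 ≤ q) (hD : ∀ u, ⟪e, u⟫_ℝ = 0 → ⟪e, D u⟫_ℝ = 0 ∧ ‖D u‖ ≤ q * ‖u‖)
    {ε : ℝ} (hε : 0 < ε) :
    ∀ᶠ N : ℝ in atTop, ‖T + N • D‖ ≤ N + ⟪T e, e⟫_ℝ + ε := by
  set t := ⟪T e, e⟫_ℝ with ht
  set K := ‖T‖ with hK
  have hK0 : 0 ≤ K := norm_nonneg _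
  have hδ : 0 < 1 - q ^ 2 := by nlinarith
  set δ := 1 - q ^ 2 with hδdef
  filter_upwards [eventually_ge_atTop 0, eventually_ge_atTop (-(t + ε)),
    eventually_ge_atTop ((K ^ 2 + 9 * K ^ 2 / δ) / (2 * ε))] with N hN0 hN1 hN2
  rw [div_le_iff₀ (by positivity)] at hN2
  have hL : 0 ≤ N + t + ε := by linarith
  refine ContinuousLinearMap.opNorm_le_bound _ hL fun x => ?_
  refine abs_le_of_sq_le_sq' ?_ (by positivity) |>.2
  set α := ⟪e, x⟫_ℝ with hα
  obtain ⟨u, hu⟩ : ∃ u, u = x - α • e := ⟨_, rfl⟩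
  have hx : x = α • e + u := by rw [hu]; abel
  have heu : ⟪e, u⟫_ℝ = 0 := by
    rw [hu, inner_sub_right, inner_smul_right, real_inner_self_eq_norm_sq, he]
    simp [hα]
  obtain ⟨hDu, hDu'⟩ := hD u heu
  have hxx : ‖x‖ ^ 2 = α ^ 2 + ‖u‖ ^ 2 := by
    rw [hx, norm_add_sq_real, inner_smul_left, heu, norm_smul, he]
    simp
  have hDx : D x = α • e + D u := by
    conv_lhs => rw [hx]
    rw [map_add, map_smul, hDe]
  have hDD : ‖D x‖ ^ 2 ≤ ‖x‖ ^ 2 - δ * ‖u‖ ^ 2 := by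
    have h1 : ‖D x‖ ^ 2 = α ^ 2 + ‖D u‖ ^ 2 := by
      rw [hDx, norm_add_sq_real, inner_smul_left, hDu, norm_smul, he]
      simp
    have h2 : ‖D u‖ ^ 2 ≤ (q * ‖u‖) ^ 2 := by gcongr
    rw [h1, hxx, hδdef]; nlinarith
  have hux : ‖u‖ ≤ ‖x‖ := by
    refine abs_le_of_sq_le_sq' ?_ (norm_nonneg _) |>.2
    rw [hxx]; nlinarith [sq_nonneg α]
  have hαx : |α| ≤ ‖x‖ := by
    refine abs_le_of_sq_le_sq ?_ (norm_nonneg _)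
    rw [hxx]; nlinarith [sq_nonneg ‖u‖]
  have htK : |t| ≤ K := by
    refine (abs_real_inner_le_norm _ _).trans ?_
    simpa [he] using T.le_opNorm e
  have hTD : ⟪T x, D x⟫_ℝ ≤ t * ‖x‖ ^ 2 + 3 * K * (‖x‖ * ‖u‖) := by
    have h1 : ⟪T x, D x⟫_ℝ = α ^ 2 * t + α * ⟪T u, e⟫_ℝ + ⟪T x, D u⟫_ℝ := by
      rw [hDx, inner_add_right, inner_smul_right]
      congr 1
      conv_lhs => rw [hx]
      rw [map_add, map_smul, inner_add_left, inner_smul_left, ← ht]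
      simp; ring
    have h2 : α * ⟪T u, e⟫_ℝ ≤ ‖x‖ * (K * ‖u‖) := by
      refine (le_abs_self _).trans ?_
      rw [abs_mul]
      gcongr
      refine (abs_real_inner_le_norm _ _).trans ?_
      simpa [he] using T.le_opNorm u
    have h3 : ⟪T x, D u⟫_ℝ ≤ (K * ‖x‖) * ‖u‖ := by
      refine (real_inner_le_norm _ _).trans ?_
      gcongr
      · exact T.le_opNorm x
      · exact hDu'.trans (mul_le_of_le_one_left (norm_nonneg _) hq1.le)
    have h4 : α ^ 2 * t ≤ t * ‖x‖ ^ 2 + K * (‖x‖ * ‖u‖) := by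
      have h5 : -t * ‖u‖ ^ 2 ≤ K * (‖x‖ * ‖u‖) := by
        have : ‖u‖ ^ 2 ≤ ‖x‖ * ‖u‖ := by nlinarith [norm_nonneg u]
        calc -t * ‖u‖ ^ 2 ≤ K * ‖u‖ ^ 2 := by
              gcongr; exact (neg_le_abs t).trans htK
          _ ≤ _ := by gcongr
      have h6 : α ^ 2 * t = t * ‖x‖ ^ 2 + -t * ‖u‖ ^ 2 := by rw [hxx]; ring
      linarith
    rw [h1]; linarith
  have hT : ‖T x‖ ^ 2 ≤ K ^ 2 * ‖x‖ ^ 2 := by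
    rw [← mul_pow]; gcongr; exact T.le_opNorm x
  have hsq : ‖(T + N • D) x‖ ^ 2 = ‖T x‖ ^ 2 + 2 * N * ⟪T x, D x⟫_ℝ + N ^ 2 * ‖D x‖ ^ 2 := by
    rw [add_apply, smul_apply, norm_add_sq_real, inner_smul_right, norm_smul,
      mul_pow, Real.norm_eq_abs, sq_abs]
    ring
  have hamgm : 6 * K * N * (‖x‖ * ‖u‖) ≤ δ * N ^ 2 * ‖u‖ ^ 2 + 9 * K ^ 2 / δ * ‖x‖ ^ 2 := by
    have h := sq_nonneg (δ * N * ‖u‖ - 3 * K * ‖x‖)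
    have : δ * N ^ 2 * ‖u‖ ^ 2 + 9 * K ^ 2 / δ * ‖x‖ ^ 2 - 6 * K * N * (‖x‖ * ‖u‖) =
        (δ * N * ‖u‖ - 3 * K * ‖x‖) ^ 2 / δ := by field_simp; ring
    have := this ▸ div_nonneg h hδ.le
    linarith
  rw [hsq]
  have s1 := mul_le_mul_of_nonneg_left hTD (by positivity : 0 ≤ 2 * N)
  have s2 := mul_le_mul_of_nonneg_left hDD (sq_nonneg N)
  have s3 := mul_le_mul_of_nonneg_right hN2 (sq_nonneg ‖x‖)
  have s4 : 0 ≤ (t + ε) ^ 2 * ‖x‖ ^ 2 := by positivity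
  linarith

theorem eventually_opNorm_add_smul_le (T : Matrix (Fin n) (Fin n) ℝ) {d : Fin n → ℝ} {i : Fin n}
    (hi : d i = 1) (hd : ∀ j, j ≠ i → |d j| < 1) {ε : ℝ} (hε : 0 < ε) :
    ∀ᶠ N : ℝ in atTop, opNorm (T + N • Matrix.diagonal d) ≤ N + T i i + ε := by
  classical
  obtain ⟨q, hq0, hq1, hq⟩ : ∃ q : ℝ, 0 ≤ q ∧ q < 1 ∧ ∀ j, j ≠ i → |d j| ≤ q := by
    have : Nonempty (Fin n) := ⟨i⟩
    obtain ⟨j₀, hj₀⟩ := Finite.exists_max fun j => |Function.update d i 0 j|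
    refine ⟨_, abs_nonneg (Function.update d i 0 j₀), ?_, fun j hj => ?_⟩
    · by_cases h : j₀ = i
      · simp [h]
      · simpa [h] using hd j₀ h
    · simpa [hj] using hj₀ j
  have key := eventually_norm_add_smul_le
    (LinearMap.toContinuousLinearMap (Matrix.toEuclideanLin T))
    (LinearMap.toContinuousLinearMap (Matrix.toEuclideanLin (Matrix.diagonal d)))
    (e := EuclideanSpace.single i 1) (by simp) ?_ hq1 hq0 ?_ hε
  · filter_upwards [key] with N hN
    rw [LinearMap.coe_toContinuousLinearMap', inner_toEuclideanLin_single] at hN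
    simpa [opNorm] using hN
  · ext j
    by_cases hj : j = i
    · subst hj; simp [Matrix.toLpLin_apply, hi]
    · simp [Matrix.toLpLin_apply, hj]
  · intro u hu
    have hui : u i = 0 := by simpa [EuclideanSpace.inner_single_left] using hu
    refine ⟨by simp [EuclideanSpace.inner_single_left, Matrix.toLpLin_apply,
      Matrix.mulVec_diagonal, hui], ?_⟩
    refine abs_le_of_sq_le_sq' ?_ (by positivity) |>.2
    rw [mul_pow, EuclideanSpace.norm_sq_eq, EuclideanSpace.norm_sq_eq, Finset.mul_sum]
    refine Finset.sum_le_sum fun j _ => ?_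
    by_cases hj : j = i
    · subst hj; simp [Matrix.toLpLin_apply, Matrix.mulVec_diagonal, hui]
    · have := hq j hj
      simp only [LinearMap.coe_toContinuousLinearMap', Matrix.toLpLin_apply,
        Matrix.mulVec_diagonal, norm_mul, mul_pow, Real.norm_eq_abs]
      gcongr

theorem eventually_opNorm_diagonal_add_smul_le {t d : Fin n → ℝ} {i : Fin n} (hi : d i = 1)
    (hd : ∀ j, |d j| < 1 ∨ (d j = d i ∧ t j = t i) ∨ (d j = -d i ∧ t j = -t i)) :
    ∀ᶠ N : ℝ in atTop, opNorm (Matrix.diagonal t + N • Matrix.diagonal d) ≤ N + t i := by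
  have ev : ∀ᶠ N : ℝ in atTop, ∀ j, |d j| < 1 → N * |d j| + |t j| < N * 1 + t i := by
    rw [eventually_all]
    intro j
    by_cases hj : |d j| < 1
    · exact (eventually_add_lt hj.le (Or.inl hj)).mono fun N h _ => h
    · exact Eventually.of_forall fun N h => absurd h hj
  filter_upwards [ev, eventually_ge_atTop 0, eventually_ge_atTop (-t i)] with N hN hN0 hN1
  have h0 : 0 ≤ N + t i := by linarith
  rw [← Matrix.diagonal_smul, Matrix.diagonal_add]
  refine opNorm_diagonal_le h0 fun j => ?_
  simp only [Pi.smul_apply, smul_eq_mul]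
  rcases hd j with h | ⟨h1, h2⟩ | ⟨h1, h2⟩
  · have := hN j h
    calc |t j + N * d j| ≤ |t j| + N * |d j| := by
          simpa [abs_mul, abs_of_nonneg hN0] using abs_add_le (t j) (N * d j)
      _ ≤ _ := by linarith
  · rw [h1, h2, hi, abs_le]; constructor <;> linarith
  · rw [h1, h2, hi, abs_le]; constructor <;> linarith

end OperatorNorm

section Coapproximation

variable {m n : ℕ} {a : Fin m → Fin n → ℝ}

/-- `diag (diagComb a β)` is a best coapproximation to `T` out of the span. -/
def IsCoapprox (a : Fin m → Fin n → ℝ) (T : Matrix (Fin n) (Fin n) ℝ) (β : Fin m → ℝ) : Prop :=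
  ∀ γ, opNorm (Matrix.diagonal (diagComb a β) - Matrix.diagonal (diagComb a γ)) ≤
    opNorm (T - Matrix.diagonal (diagComb a γ))

theorem IsCoapprox.neg {T : Matrix (Fin n) (Fin n) ℝ} {β : Fin m → ℝ} (h : IsCoapprox a T β) :
    IsCoapprox a (-T) (-β) := by
  intro γ
  have := h (-γ)
  rw [← opNorm_neg, ← opNorm_neg (T - _)] at this
  have e : ∀ δ, Matrix.diagonal (diagComb a (-δ)) = -Matrix.diagonal (diagComb a δ) := fun δ => by
    rw [map_neg]; exact (Matrix.diagonal_neg _).symm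
  simp only [e] at this ⊢
  convert this using 2 <;> abel

theorem IsCoapprox.diagComb_le {T : Matrix (Fin n) (Fin n) ℝ} {β γ : Fin m → ℝ} {i : Fin n}
    {t : ℝ} (h : IsCoapprox a T β) (hγ : diagComb a γ i = 1)
    (hT : ∀ ε > 0, ∀ᶠ N : ℝ in atTop,
      opNorm (T + N • Matrix.diagonal (diagComb a γ)) ≤ N + t + ε) :
    diagComb a β i ≤ t := by
  refine le_of_forall_pos_le_add fun ε hε => ?_
  obtain ⟨N, hN⟩ := (hT ε hε).exists
  have h1 := h (-N • γ)
  have h2 := abs_diag_le_opNorm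
    (Matrix.diagonal (diagComb a β) - Matrix.diagonal (diagComb a (-N • γ))) i
  have h3 : T - Matrix.diagonal (diagComb a (-N • γ)) =
      T + N • Matrix.diagonal (diagComb a γ) := by
    rw [map_smul, Matrix.diagonal_smul, neg_smul, sub_neg_eq_add]
  rw [h3, map_smul] at h1
  simp only [Matrix.sub_apply, Matrix.diagonal_apply_eq, map_smul, Pi.smul_apply, hγ,
    smul_eq_mul, mul_one, sub_neg_eq_add] at h2
  linarith [le_abs_self (diagComb a β i + N)]

theorem IsCoapprox.diagComb_eq_of_subsingleton {T : Matrix (Fin n) (Fin n) ℝ} {β : Fin m → ℝ}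
    {i : Fin n} (h : IsCoapprox a T β) (hi : StarProperty a i)
    (hS : ∀ j, EquivComp a i j → j = i) : diagComb a β i = T i i := by
  obtain ⟨γ, hγ, hlt⟩ := hi.exists_normalized
  have hd : ∀ j, j ≠ i → |diagComb a γ j| < 1 := fun j hj => hlt j (mt (hS j) hj)
  refine le_antisymm
    (h.diagComb_le hγ fun ε hε => eventually_opNorm_add_smul_le T hγ hd hε) ?_
  have := h.neg.diagComb_le hγ fun ε hε => eventually_opNorm_add_smul_le (-T) hγ hd hε
  simpa using this

theorem IsCoapprox.diagComb_eq_of_diagonal {t : Fin n → ℝ} {β : Fin m → ℝ} {i : Fin n}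
    (h : IsCoapprox a (Matrix.diagonal t) β) (hi : StarProperty a i)
    (ht : ∀ j, EquivComp a i j → (comp a j = comp a i ∧ t j = t i) ∨
      (comp a j = -comp a i ∧ t j = -t i)) : diagComb a β i = t i := by
  obtain ⟨γ, hγ, hlt⟩ := hi.exists_normalized
  have hd : ∀ j, |diagComb a γ j| < 1 ∨ (diagComb a γ j = diagComb a γ i ∧ t j = t i) ∨
      (diagComb a γ j = -diagComb a γ i ∧ t j = -t i) := by
    intro j
    by_cases hj : EquivComp a i j
    · right
      rcases ht j hj with ⟨h1, h2⟩ | ⟨h1, h2⟩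
      · refine Or.inl ⟨?_, h2⟩
        simp only [diagComb_apply]
        exact Finset.sum_congr rfl fun k _ => by rw [show a k j = a k i from congrFun h1 k]
      · refine Or.inr ⟨?_, h2⟩
        simp only [diagComb_apply, ← Finset.sum_neg_distrib]
        exact Finset.sum_congr rfl fun k _ => by
          rw [show a k j = -a k i from congrFun h1 k, mul_neg]
    · exact Or.inl (hlt j hj)
  refine le_antisymm (h.diagComb_le hγ fun ε hε => ?_) ?_
  · filter_upwards [eventually_opNorm_diagonal_add_smul_le hγ hd] with N hN
    linarith
  · have := h.neg.diagComb_le (t := -t i) hγ fun ε hε => by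
      have h' := eventually_opNorm_diagonal_add_smul_le (t := -t) hγ fun j => by
        simpa [neg_eq_iff_eq_neg] using hd j
      rw [show -Matrix.diagonal t = Matrix.diagonal (-t) from Matrix.diagonal_neg t]
      filter_upwards [h'] with N hN
      simp only [Pi.neg_apply] at hN
      linarith
    simpa using this

theorem isCoapprox_iff {T : Matrix (Fin n) (Fin n) ℝ} {β : Fin m → ℝ} :
    IsCoapprox a T β ↔
      ∀ C ∈ Submodule.span ℝ (Set.range fun k => Matrix.diagonal (a k)),
        opNorm (Matrix.diagonal (diagComb a β) - C) ≤ opNorm (T - C) := by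
  simp only [mem_span_diagonal_iff, forall_exists_index, forall_apply_eq_imp_iff, IsCoapprox]

theorem existsUnique_coapprox_iff (ha : LinearIndependent ℝ fun k => Matrix.diagonal (a k))
    (T : Matrix (Fin n) (Fin n) ℝ) :
    (∃! B : Matrix (Fin n) (Fin n) ℝ,
      B ∈ Submodule.span ℝ (Set.range fun k => Matrix.diagonal (a k)) ∧
        ∀ C ∈ Submodule.span ℝ (Set.range fun k => Matrix.diagonal (a k)),
          opNorm (B - C) ≤ opNorm (T - C)) ↔ ∃! β, IsCoapprox a T β := by
  constructor
  · rintro ⟨B, ⟨hB, hco⟩, huniq⟩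
    obtain ⟨β, rfl⟩ := (mem_span_diagonal_iff a B).mp hB
    refine ⟨β, isCoapprox_iff.mpr hco, fun γ hγ => ?_⟩
    exact diagComb_injective a ha (Matrix.diagonal_injective
      (huniq _ ⟨(mem_span_diagonal_iff a _).mpr ⟨γ, rfl⟩, isCoapprox_iff.mp hγ⟩))
  · rintro ⟨β, hβ, huniq⟩
    refine ⟨_, ⟨(mem_span_diagonal_iff a _).mpr ⟨β, rfl⟩, isCoapprox_iff.mp hβ⟩, ?_⟩
    rintro B ⟨hB, hco⟩
    obtain ⟨γ, rfl⟩ := (mem_span_diagonal_iff a B).mp hB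
    rw [huniq γ (isCoapprox_iff.mpr hco)]

variable {p : ℕ} {f : Fin p → Fin n}

theorem abs_diagComb_le (hall : ∀ i, StarProperty a i → ∃ s, EquivComp a i (f s))
    {β : Fin m → ℝ} {r : ℝ} (hr : 0 ≤ r) (h : ∀ s, |diagComb a β (f s)| ≤ r) (j : Fin n) :
    |diagComb a β j| ≤ r := by
  by_cases h0 : diagComb a β = 0
  · simpa [h0] using hr
  · obtain ⟨i, hi, hmax⟩ := exists_starProperty_max β h0
    obtain ⟨s, hs⟩ := hall i hi
    exact (hmax j).trans (hs.abs_diagComb β ▸ h s)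

theorem isCoapprox_of_abs_le (hall : ∀ i, StarProperty a i → ∃ s, EquivComp a i (f s))
    {T : Matrix (Fin n) (Fin n) ℝ} {β : Fin m → ℝ}
    (h : ∀ γ s, |diagComb a β (f s) - diagComb a γ (f s)| ≤
      opNorm (T - Matrix.diagonal (diagComb a γ))) : IsCoapprox a T β := by
  intro γ
  rw [Matrix.diagonal_sub]
  refine opNorm_diagonal_le (opNorm_nonneg _) fun j => ?_
  have := abs_diagComb_le hall (β := β - γ) (opNorm_nonneg _) (by simpa using h γ) j
  simpa using this

theorem funLeft_diagComb_injective (ha : LinearIndependent ℝ fun k => Matrix.diagonal (a k))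
    (hall : ∀ i, StarProperty a i → ∃ s, EquivComp a i (f s)) :
    Function.Injective (LinearMap.funLeft ℝ ℝ f ∘ₗ diagComb a) := by
  rw [← LinearMap.ker_eq_bot, LinearMap.ker_eq_bot']
  intro β hβ
  refine (map_eq_zero_iff _ (diagComb_injective a ha)).mp (funext fun j => ?_)
  have := abs_diagComb_le hall le_rfl (fun s => (abs_eq_zero.mpr (congrFun hβ s)).le) j
  simpa using this

end Coapproximation

/-- `span{A₁,…,A_m}` is co-Chebyshev in `Mₙ` iff the number of pairwise nonequivalent
components satisfying the `*`-Property is `p = m` and each of their `Sᵢ` is a singleton. -/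
theorem coChebyshev_iff (m n : ℕ) (hm : 0 < m) (hn : 0 < n)
    (a : Fin m → Fin n → ℝ)
    (ha : LinearIndependent ℝ fun k => Matrix.diagonal (a k))
    (p : ℕ) (f : Fin p → Fin n)
    (hstar : ∀ s, StarProperty a (f s))
    (hnoneq : ∀ s t, s ≠ t → ¬ EquivComp a (f s) (f t))
    (hall : ∀ i : Fin n, StarProperty a i → ∃ s, EquivComp a i (f s)) :
    (∀ T : Matrix (Fin n) (Fin n) ℝ,
        ∃! B : Matrix (Fin n) (Fin n) ℝ,
          B ∈ Submodule.span ℝ (Set.range fun k => Matrix.diagonal (a k)) ∧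
            ∀ C ∈ Submodule.span ℝ (Set.range fun k => Matrix.diagonal (a k)),
              opNorm (B - C) ≤ opNorm (T - C)) ↔
      (p = m ∧ ∀ s : Fin p, (Sset a (f s)).ncard = 1) := by
  simp only [existsUnique_coapprox_iff ha]
  set L := LinearMap.funLeft ℝ ℝ f ∘ₗ diagComb a with hL
  have hLa : ∀ β s, L β s = diagComb a β (f s) := fun _ _ => rfl
  have hinj : Function.Injective L := funLeft_diagComb_injective ha hall
  have hself : ∀ i, EquivComp a i i := fun _ => Or.inl rfl
  constructor
  · intro H
    have hsurj : Function.Surjective L := by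
      classical
      intro t
      let τ : Fin n → ℝ := fun j =>
        if h : ∃ s, comp a j = comp a (f s) then t h.choose
        else if h : ∃ s, comp a j = -comp a (f s) then -t h.choose else 0
      have hinjf : ∀ s s', EquivComp a (f s) (f s') → s = s' := fun s s' h =>
        by_contra fun hne => hnoneq s s' hne h
      have hτ : ∀ s j, EquivComp a (f s) j → (comp a j = comp a (f s) ∧ τ j = t s) ∨
          (comp a j = -comp a (f s) ∧ τ j = -t s) := by
        intro s j hj
        by_cases h : ∃ s', comp a j = comp a (f s')
        · have hs : s = h.choose := hinjf _ _ (hj.trans (Or.inl h.choose_spec.symm))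
          have h' := h.choose_spec
          rw [← hs] at h'
          exact Or.inl ⟨h', by simp only [τ, dif_pos h, ← hs]⟩
        · have hj' : comp a j = -comp a (f s) := hj.resolve_left fun h' => h ⟨s, h'⟩
          have h2 : ∃ s', comp a j = -comp a (f s') := ⟨s, hj'⟩
          have hs : s = h2.choose := hinjf _ _
            (hj.trans (EquivComp.symm (Or.inr h2.choose_spec)))
          exact Or.inr ⟨hj', by simp only [τ, dif_neg h, dif_pos h2, ← hs]⟩
      have hτs : ∀ s, τ (f s) = t s := by
        intro s
        have h : ∃ s', comp a (f s) = comp a (f s') := ⟨s, rfl⟩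
        have hs : s = h.choose := hinjf _ _ (Or.inl h.choose_spec.symm)
        simp only [τ, dif_pos h, ← hs]
      obtain ⟨β, hβ, -⟩ := H (Matrix.diagonal τ)
      refine ⟨β, funext fun s => ?_⟩
      rw [hLa, hβ.diagComb_eq_of_diagonal (hstar s) (by simpa only [hτs] using hτ s), hτs]
    have hpm : p = m := by
      have := (LinearEquiv.ofBijective L ⟨hinj, hsurj⟩).finrank_eq
      simpa using this.symm
    refine ⟨hpm, fun s => ?_⟩
    rw [Set.ncard_eq_one]
    refine ⟨f s, Set.eq_singleton_iff_unique_mem.mpr ⟨hself _, fun j hj => ?_⟩⟩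
    by_contra hne
    have hj : EquivComp a (f s) j := hj
    obtain ⟨β, hβ⟩ := hsurj (Pi.single s 1)
    set T : Matrix (Fin n) (Fin n) ℝ := Matrix.diagonal (Pi.single (f s) 1) with hT
    have hfne : ∀ s', s' ≠ s → f s' ≠ f s := fun s' hs' h =>
      hnoneq s' s hs' (h ▸ hself _)
    have hentry : ∀ γ i, |(Pi.single (f s) 1 : Fin n → ℝ) i - diagComb a γ i| ≤
        opNorm (T - Matrix.diagonal (diagComb a γ)) := fun γ i => by
      simpa [hT] using abs_diag_le_opNorm (T - Matrix.diagonal (diagComb a γ)) i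
    have h1 : IsCoapprox a T β := isCoapprox_of_abs_le hall fun γ s' => by
      refine le_trans (le_of_eq ?_) (hentry γ (f s'))
      rw [← hLa, hβ]
      by_cases hs' : s' = s
      · subst hs'; simp
      · simp [hs', hfne s' hs']
    have h0 : IsCoapprox a T 0 := isCoapprox_of_abs_le hall fun γ s' => by
      by_cases hs' : s' = s
      · subst hs'
        have := hentry γ j
        simpa [hne, hj.abs_diagComb γ] using this
      · have := hentry γ (f s')
        simpa [hfne s' hs'] using this
    have h01 : β = 0 := (H T).unique h1 h0
    have := congrFun hβ s
    simp [h01] at this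
  · rintro ⟨rfl, hcard⟩ T
    have hsurj : Function.Surjective L := LinearMap.injective_iff_surjective.mp hinj
    have hS : ∀ s j, EquivComp a (f s) j → j = f s := by
      intro s j hj
      obtain ⟨x, hx⟩ := Set.ncard_eq_one.mp (hcard s)
      have h1 : j ∈ Sset a (f s) := hj
      have h2 : f s ∈ Sset a (f s) := hself _
      rw [hx] at h1 h2
      exact h1.trans h2.symm
    obtain ⟨β, hβ⟩ := hsurj fun s => T (f s) (f s)
    refine ⟨β, isCoapprox_of_abs_le hall fun γ s => ?_, fun γ hγ => hinj ?_⟩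
    · rw [← hLa β, hβ]
      simpa using abs_diag_le_opNorm (T - Matrix.diagonal (diagComb a γ)) (f s)
    · rw [hβ]
      funext s
      rw [hLa, hγ.diagComb_eq_of_subsingleton (hstar s) (hS s)]
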